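/- Normal form lemma: for every formula A of L(∀,□) there exists a conjunctive form F (a conjunction of elementary disjunctions) such that A ↔ F is provable in FOL□. -/

import Mathlib

namespace FOLBoxPaper

/-- Formulas of the language L(∀,□): atoms `P_j(x₁,…,xₙ)` (predicate index and
list of variables), identity `x = y`, negation, implication, universal
quantification, and the modal operator □. Variables are natural numbers. -/
inductive Formula : Type
  | atom : ℕ → List ℕ → Formula
  | eq : ℕ → ℕ → Formula
  | neg : Formula → Formula
  | imp : Formula → Formula → Formula
  | all : ℕ → Formula → Formula
  | box : Formula → Formula

namespace Formula

/-- Conjunction, defined as usual. -/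
def and (A B : Formula) : Formula := neg (imp A (neg B))

/-- Disjunction, defined as usual. -/
def or (A B : Formula) : Formula := imp (neg A) B

/-- Biconditional, defined as usual. -/
def iff (A B : Formula) : Formula := (imp A B).and (imp B A)

/-- ◇A := ¬□¬A. -/
def dia (A : Formula) : Formula := neg (box (neg A))

/-- ∃xA := ¬∀x¬A. -/
def ex (x : ℕ) (A : Formula) : Formula := neg (all x (neg A))

/-- A formula is □-free when it contains no occurrence of □. -/
def BoxFree : Formula → Prop
  | atom _ _ => True
  | eq _ _ => True
  | neg A => BoxFree A
  | imp A B => BoxFree A ∧ BoxFree B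
  | all _ A => BoxFree A
  | box _ => False

/-- `FreeIn x A`: the variable x has at least one ∀□-free occurrence in A,
i.e. an occurrence that is neither in the scope of a quantifier binding x
nor in the scope of □. -/
def FreeIn (x : ℕ) : Formula → Prop
  | atom _ args => x ∈ args
  | eq a b => x = a ∨ x = b
  | neg A => FreeIn x A
  | imp A B => FreeIn x A ∨ FreeIn x B
  | all z A => z ≠ x ∧ FreeIn x A
  | box _ => False

/-- The ∀□-free substitution `A(y/x)`: replace every ∀□-free occurrence of x
in A by y (occurrences in the scope of □ or of a quantifier binding x are
left untouched). -/
def subst (A : Formula) (y x : ℕ) : Formula :=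
  match A with
  | atom j args => atom j (args.map fun z => if z = x then y else z)
  | eq a b => eq (if a = x then y else a) (if b = x then y else b)
  | neg A => neg (subst A y x)
  | imp A B => imp (subst A y x) (subst B y x)
  | all z A => if z = x then all z A else all z (subst A y x)
  | box A => box A

/-- `Substitutable y x A`: the variable y is substitutable for the ∀□-free
occurrences of x in A, i.e. y is not captured by a quantifier when it
replaces x. -/
def Substitutable (y x : ℕ) : Formula → Prop
  | atom _ _ => True
  | eq _ _ => True
  | neg A => Substitutable y x A
  | imp A B => Substitutable y x A ∧ Substitutable y x B
  | all z A => z = x ∨ ¬ FreeIn x A ∨ (z ≠ y ∧ Substitutable y x A)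
  | box _ => True

end Formula

open Formula

/-- A first-order structure with variable domains:
a nonempty set of possible worlds, a nonempty domain of objects for each
world, and a world-relative interpretation of the predicate symbols. -/
structure Structure where
  W : Type
  wNonempty : Nonempty W
  D : W → Type
  dNonempty : ∀ w, Nonempty (D w)
  I : ℕ → (w : W) → List (D w) → Prop

/-- A valuation assigns, to each variable and world, an object of the domain
of that world. -/
def Valuation (M : Structure) : Type := ℕ → (w : M.W) → M.D w

open Classical in
/-- The variant `v^a_x(w)` of a valuation v at world w: it maps x at w to a
and agrees with v everywhere else. -/
noncomputable def updateVal {M : Structure} (v : Valuation M) (x : ℕ)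
    (w : M.W) (a : M.D w) : Valuation M :=
  fun y w' => if h : y = x ∧ w' = w then cast (congrArg M.D h.2.symm) a else v y w'

/-- Satisfaction `M, v, w ⊨ A`. The clause for □ quantifies over all
valuations and all worlds of the structure. -/
def Sat (M : Structure) : Valuation M → M.W → Formula → Prop
  | v, w, .atom j args => M.I j w (args.map fun z => v z w)
  | v, w, .eq a b => v a w = v b w
  | v, w, .neg A => ¬ Sat M v w A
  | v, w, .imp A B => Sat M v w A → Sat M v w B
  | v, w, .all x A => ∀ a : M.D w, Sat M (updateVal v x w a) w A
  | _, _, .box A => ∀ (v' : Valuation M) (w' : M.W), Sat M v' w' A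

/-- `M ⊨ A`: A is satisfied at every valuation and world of M. -/
def Models (M : Structure) (A : Formula) : Prop := ∀ v w, Sat M v w A

/-- Universal structures: M is universal when every □-free formula true
everywhere in M is true everywhere in every structure. -/
def Universal (M : Structure) : Prop :=
  ∀ B, BoxFree B → Models M B → ∀ N : Structure, Models N B

/-- Logical validity: truth at every valuation and world of every universal
structure. -/
def Valid (A : Formula) : Prop :=
  ∀ M : Structure, Universal M → ∀ (v : Valuation M) (w : M.W), Sat M v w A

/-- FOL: the set of □-free classical first-order theses, i.e. □-free formulas
satisfied at every valuation and world of every structure. -/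
def FOL : Set Formula := {A | BoxFree A ∧ ∀ M : Structure, Models M A}

/-- `PropTaut A`: A is an instantiation of a tautology of classical
propositional logic (it is true under every assignment of truth values to
formulas that respects ¬ and →). -/
def PropTaut (A : Formula) : Prop :=
  ∀ f : Formula → Prop,
    (∀ B, f (neg B) ↔ ¬ f B) → (∀ B C, f (imp B C) ↔ (f B → f C)) → f A

/-- The system FOL□. -/
inductive FOLBox : Formula → Prop
  | taut {A} : PropTaut A → FOLBox A
  | axK {A B} : FOLBox ((box (A.imp B)).imp ((box A).imp (box B)))
  | axT {A} : FOLBox ((box A).imp A)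
  | ax5 {A} : FOLBox ((neg (box A)).imp (box (neg (box A))))
  | axAll1 {A : Formula} {x y : ℕ} : Substitutable y x A →
      FOLBox ((all x A).imp (A.subst y x))
  | axAll2 {A B : Formula} {x : ℕ} : ¬ FreeIn x A →
      FOLBox ((all x (A.imp B)).imp (A.imp (all x B)))
  | axId {x : ℕ} : FOLBox (Formula.eq x x)
  | axEq {A : Formula} {x y : ℕ} : BoxFree A → Substitutable y x A →
      FOLBox (((Formula.eq x y).and A).imp (A.subst y x))
  | axMix {A : Formula} {x : ℕ} : FOLBox ((box A).imp (all x A))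
  | axBang {A} : BoxFree A → A ∉ FOL → FOLBox (neg (box A))
  | mp {A B} : FOLBox (A.imp B) → FOLBox A → FOLBox B
  | nec {A} : FOLBox A → FOLBox (box A)

/-- The conjunction of a (nonempty) finite list of formulas. -/
def conjList : List Formula → Formula
  | [] => Formula.eq 0 0
  | [A] => A
  | A :: B :: rest => A.and (conjList (B :: rest))

/-- FOL□-consistency: no finite conjunction of members of Γ has its negation
in FOL□. -/
def Consistent (Γ : Set Formula) : Prop :=
  ∀ L : List Formula, L ≠ [] → (∀ B ∈ L, B ∈ Γ) → ¬ FOLBox (neg (conjList L))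

/-- Maximal FOL□-consistency. -/
def MaxConsistent (Γ : Set Formula) : Prop :=
  Consistent Γ ∧ ∀ A, A ∈ Γ ∨ neg A ∈ Γ

/-- ∃-saturation: whenever ¬∀xA ∈ Γ there is a variable y with
¬A(y/x) ∈ Γ via a ∀□-free substitution. -/
def Saturated (Γ : Set Formula) : Prop :=
  ∀ (x : ℕ) (A : Formula), neg (all x A) ∈ Γ →
    ∃ y : ℕ, Substitutable y x A ∧ neg (A.subst y x) ∈ Γ

/-- MC: the family of all ∃-saturated maximal FOL□-consistent sets. -/
def MC : Set (Set Formula) := {Γ | Saturated Γ ∧ MaxConsistent Γ}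

/-- An elementary disjunction: a formula of the form
`A ∨ ◇B ∨ □C₁ ∨ … ∨ □Cₙ` with A, B, C₁, …, Cₙ □-free. -/
def ElemDisj (D : Formula) : Prop :=
  ∃ (A B : Formula) (Cs : List Formula),
    BoxFree A ∧ BoxFree B ∧ (∀ C ∈ Cs, BoxFree C) ∧
    D = (Cs.map Formula.box).foldl Formula.or (A.or B.dia)

/-- A conjunctive form: a conjunction of elementary disjunctions. -/
def ConjForm (F : Formula) : Prop :=
  ∃ Ds : List Formula, Ds ≠ [] ∧ (∀ D ∈ Ds, ElemDisj D) ∧ F = conjList Ds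

/-- The worlds of the canonical structure: members of MC. -/
def MCW : Type := {Γ : Set Formula // Γ ∈ MC}

/-- The relation ∼_Γ on variables: x ∼_Γ y iff the formula x = y belongs
to Γ. -/
def canonRel (Γ : MCW) (x y : ℕ) : Prop := Formula.eq x y ∈ Γ.val

/-- The canonical structure 𝒜^MC: worlds are the members of MC, the domain
of a world Γ consists of the classes [x]_{∼_Γ} of variables, and a predicate
holds of such classes iff the corresponding atomic formula belongs to Γ. -/
noncomputable def canonicalStructure (h : Nonempty MCW) : Structure where
  W := MCW
  wNonempty := h
  D := fun Γ => Quot (canonRel Γ)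
  dNonempty := fun Γ => ⟨Quot.mk _ 0⟩
  I := fun j Γ ds =>
    ∃ xs : List ℕ, ds = xs.map (Quot.mk (canonRel Γ)) ∧ Formula.atom j xs ∈ Γ.val

/-- The canonical valuation v^MC: v^MC(x, Γ) = [x]_{∼_Γ}. -/
noncomputable def canonicalVal (h : Nonempty MCW) : Valuation (canonicalStructure h) :=
  fun x Γ => Quot.mk (canonRel Γ) x

/-- `f` is a truth assignment respecting negation and implication. -/
structure IsBoolVal (f : Formula → Prop) : Prop where
  neg : ∀ B, f (neg B) ↔ ¬ f B
  imp : ∀ B C, f (imp B C) ↔ (f B → f C)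

namespace IsBoolVal

variable {f : Formula → Prop}

theorem and (hf : IsBoolVal f) (A B : Formula) : f (A.and B) ↔ f A ∧ f B := by
  simp [Formula.and, hf.neg, hf.imp]

theorem or (hf : IsBoolVal f) (A B : Formula) : f (A.or B) ↔ f A ∨ f B := by
  simp only [Formula.or, hf.neg, hf.imp]; tauto

theorem iff (hf : IsBoolVal f) (A B : Formula) : f (A.iff B) ↔ (f A ↔ f B) := by
  simp only [Formula.iff, hf.and, hf.imp]; tauto

theorem dia (hf : IsBoolVal f) (A : Formula) : f A.dia ↔ ¬ f (box A.neg) :=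
  hf.neg _

end IsBoolVal

namespace FOLBox

variable {A B C D G : Formula} {x : ℕ}

theorem of_taut (h : ∀ f, IsBoolVal f → f A := by
    intro f hf; simp only [hf.neg, hf.imp, hf.and, hf.or, hf.iff, hf.dia] <;> tauto) :
    FOLBox A :=
  taut fun f hn hi => h f ⟨hn, hi⟩

theorem of_taut₁ (hA : FOLBox A) (h : ∀ f, IsBoolVal f → f A → f B := by
    intro f hf; simp only [hf.neg, hf.imp, hf.and, hf.or, hf.iff, hf.dia] <;> tauto) :
    FOLBox B :=
  mp (of_taut fun f hf => (hf.imp _ _).2 (h f hf)) hA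

theorem of_taut₂ (hA : FOLBox A) (hB : FOLBox B) (h : ∀ f, IsBoolVal f → f A → f B → f C := by
    intro f hf; simp only [hf.neg, hf.imp, hf.and, hf.or, hf.iff, hf.dia] <;> tauto) :
    FOLBox C :=
  mp (of_taut₁ hA fun f hf a => (hf.imp _ _).2 (h f hf a)) hB

theorem of_taut₃ (hA : FOLBox A) (hB : FOLBox B) (hC : FOLBox C)
    (h : ∀ f, IsBoolVal f → f A → f B → f C → f D := by
      intro f hf; simp only [hf.neg, hf.imp, hf.and, hf.or, hf.iff, hf.dia] <;> tauto) :
    FOLBox D :=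
  mp (of_taut₂ hA hB fun f hf a b => (hf.imp _ _).2 (h f hf a b)) hC

theorem box_mono (h : FOLBox (A.imp B)) : FOLBox ((box A).imp (box B)) :=
  mp axK (nec h)

theorem gen (h : FOLBox A) : FOLBox (all x A) :=
  mp axMix (nec h)

theorem substitutable_self (x : ℕ) (A : Formula) : Substitutable x x A := by
  induction A with
  | all z A ih => simp only [Substitutable]; tauto
  | _ => simp_all [Substitutable]

theorem subst_self (x : ℕ) (A : Formula) : A.subst x x = A := by
  have h : (fun z => if z = x then x else z) = id := by grind
  induction A <;> simp_all [subst]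

theorem all_elim : FOLBox ((all x A).imp A) := by
  simpa only [subst_self] using axAll1 (A := A) (substitutable_self x A)

theorem all_intro (hG : ¬ FreeIn x G) (h : FOLBox (G.imp A)) : FOLBox (G.imp (all x A)) :=
  mp (axAll2 hG) (gen h)

theorem box_four : FOLBox ((box A).imp (box (box A))) :=
  have h5 : FOLBox ((box A).neg.imp (box (box A).neg)) := ax5
  have hT : FOLBox ((box (box A).neg).imp (box A).neg) := axT
  have h5' : FOLBox ((box (box A).neg).neg.imp (box (box (box A).neg).neg)) := ax5
  have hm : FOLBox ((box (box (box A).neg).neg).imp (box (box A))) := box_mono (of_taut₁ h5)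
  of_taut₃ hT h5' hm

end FOLBox

/-- `G` and its negation each provably imply their own necessitation. -/
def Stable (G : Formula) : Prop :=
  FOLBox (G.imp (box G)) ∧ FOLBox (G.neg.imp (box G.neg))

namespace Stable

variable {G H A : Formula}

theorem box : Stable (box A) := ⟨FOLBox.box_four, FOLBox.ax5⟩

theorem neg (h : Stable G) : Stable G.neg :=
  ⟨h.2, FOLBox.of_taut₂ h.1 (FOLBox.box_mono (A := G) (B := G.neg.neg) FOLBox.of_taut)⟩

theorem imp (hG : Stable G) (hH : Stable H) : Stable (G.imp H) := by
  have hnG : FOLBox (G.neg.box.imp (G.imp H).box) := FOLBox.box_mono FOLBox.of_taut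
  have hH' : FOLBox (H.box.imp (G.imp H).box) := FOLBox.box_mono FOLBox.of_taut
  have hneg : FOLBox (G.box.imp (H.neg.imp (G.imp H).neg).box) := FOLBox.box_mono FOLBox.of_taut
  have hK : FOLBox ((H.neg.imp (G.imp H).neg).box.imp (H.neg.box.imp (G.imp H).neg.box)) :=
    FOLBox.axK
  have hpos : FOLBox (G.neg.imp (G.imp H).box) := FOLBox.of_taut₂ hG.2 hnG
  have hneg' : FOLBox (G.imp (H.neg.box.imp (G.imp H).neg.box)) := FOLBox.of_taut₃ hG.1 hneg hK
  exact ⟨FOLBox.of_taut₃ hpos hH' hH.1, FOLBox.of_taut₂ hneg' hH.2⟩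

theorem box_intro (hG : Stable G) (h : FOLBox (G.imp A)) : FOLBox (G.imp A.box) :=
  FOLBox.of_taut₂ hG.1 (FOLBox.box_mono h)

end Stable

/-- The features shared by `□` and `∀x`: `Q` is a factive operator, and `S` is a Boolean-closed
class of formulas, containing all `Q A` and `□A`, under which one may generalize with `Q`. -/
structure IsUniversalOp (Q : Formula → Formula) (S : Formula → Prop) : Prop where
  elim : ∀ A, FOLBox ((Q A).imp A)
  intro : ∀ {G A}, S G → FOLBox (G.imp A) → FOLBox (G.imp (Q A))
  self : ∀ A, S (Q A)
  box : ∀ A, S (box A)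
  neg : ∀ {A}, S A → S A.neg
  imp : ∀ {A B}, S A → S B → S (A.imp B)

theorem isUniversalOp_box : IsUniversalOp box Stable where
  elim _ := FOLBox.axT
  intro := Stable.box_intro
  self _ := Stable.box
  box _ := Stable.box
  neg := Stable.neg
  imp := Stable.imp

theorem isUniversalOp_all (x : ℕ) : IsUniversalOp (all x) fun A => ¬ FreeIn x A where
  elim _ := FOLBox.all_elim
  intro := FOLBox.all_intro
  self _ := by simp [FreeIn]
  box _ := by simp [FreeIn]
  neg h := h
  imp hA hB := by simp [FreeIn, hA, hB]

namespace IsUniversalOp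

variable {Q : Formula → Formula} {S : Formula → Prop} {A B R : Formula}

theorem mono (hQ : IsUniversalOp Q S) (h : FOLBox (A.imp B)) : FOLBox ((Q A).imp (Q B)) :=
  hQ.intro (hQ.self A) (FOLBox.of_taut₂ (hQ.elim A) h)

theorem congr (hQ : IsUniversalOp Q S) (h : FOLBox (A.iff B)) : FOLBox ((Q A).iff (Q B)) :=
  FOLBox.of_taut₂ (hQ.mono (A := A) (B := B) (FOLBox.of_taut₁ h))
    (hQ.mono (A := B) (B := A) (FOLBox.of_taut₁ h))

theorem and_iff (hQ : IsUniversalOp Q S) (A B : Formula) :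
    FOLBox ((Q (A.and B)).iff ((Q A).and (Q B))) :=
  have hl : FOLBox ((Q (A.and B)).imp (Q A)) := hQ.mono FOLBox.of_taut
  have hr : FOLBox ((Q (A.and B)).imp (Q B)) := hQ.mono FOLBox.of_taut
  have hi : FOLBox (((Q A).and (Q B)).imp (Q (A.and B))) :=
    hQ.intro (hQ.neg (hQ.imp (hQ.self A) (hQ.neg (hQ.self B))))
      (FOLBox.of_taut₂ (hQ.elim A) (hQ.elim B))
  FOLBox.of_taut₃ hl hr hi

theorem or_iff (hQ : IsUniversalOp Q S) (A : Formula) (hR : S R) :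
    FOLBox ((Q (A.or R)).iff ((Q A).or R)) :=
  have hl : FOLBox (((Q (A.or R)).and R.neg).imp (Q A)) :=
    hQ.intro (hQ.neg (hQ.imp (hQ.self _) (hQ.neg (hQ.neg hR))))
      (FOLBox.of_taut₁ (hQ.elim (A.or R)))
  have hr : FOLBox (((Q A).or R).imp (Q (A.or R))) :=
    hQ.intro (hQ.imp (hQ.neg (hQ.self A)) hR) (FOLBox.of_taut₁ (hQ.elim A))
  FOLBox.of_taut₂ hl hr

end IsUniversalOp

theorem FOLBox.dia_or_iff (A B : Formula) :
    FOLBox ((A.or B).dia.iff (A.dia.or B.dia)) :=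
  have h : FOLBox ((A.or B).neg.box.iff (A.neg.and B.neg).box) :=
    isUniversalOp_box.congr of_taut
  of_taut₂ h (isUniversalOp_box.and_iff A.neg B.neg)

theorem ElemDisj.or_box {D C : Formula} (hD : ElemDisj D) (hC : BoxFree C) :
    ElemDisj (D.or C.box) := by
  obtain ⟨A, B, Cs, hA, hB, hCs, rfl⟩ := hD
  refine ⟨A, B, Cs ++ [C], hA, hB, ?_, by simp⟩
  simp only [List.mem_append, List.mem_singleton]
  rintro E (hE | rfl)
  exacts [hCs E hE, hC]

theorem ElemDisj.induction {P : ∀ D, ElemDisj D → Prop}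
    (base : ∀ A B, BoxFree A → BoxFree B → ∀ h : ElemDisj (A.or B.dia), P _ h)
    (step : ∀ D C (hC : BoxFree C) (hD : ElemDisj D), P D hD → P _ (hD.or_box hC))
    {D : Formula} (hD : ElemDisj D) : P D hD := by
  obtain ⟨A, B, Cs, hA, hB, hCs, rfl⟩ := id hD
  induction Cs using List.reverseRecOn with
  | nil => exact base A B hA hB hD
  | append_singleton Cs C ih =>
    simp only [List.mem_append, List.mem_singleton] at hCs
    have hCs' : ∀ E ∈ Cs, BoxFree E := fun E hE => hCs E (.inl hE)
    simpa using step _ C (hCs C (.inr rfl)) _ (ih hCs' ⟨A, B, Cs, hA, hB, hCs', rfl⟩)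

theorem ElemDisj.conjForm {D : Formula} (hD : ElemDisj D) : ConjForm D :=
  ⟨[D], by simp, by simpa using hD, rfl⟩

theorem ConjForm.induction {P : ∀ F, ConjForm F → Prop}
    (base : ∀ D (hD : ElemDisj D), P D hD.conjForm)
    (and : ∀ D E (hD : ConjForm D) (hE : ConjForm E) (h : ConjForm (D.and E)),
      P D hD → P E hE → P _ h)
    {F : Formula} (hF : ConjForm F) : P F hF := by
  obtain ⟨Ds, hne, hDs, rfl⟩ := id hF
  induction Ds with
  | nil => exact absurd rfl hne
  | cons D Ds ih =>
    have hD := hDs D (by simp)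
    cases Ds with
    | nil => exact base D hD
    | cons E Ds =>
      have hEs : ∀ F ∈ E :: Ds, ElemDisj F := fun F hF => hDs F (List.mem_cons_of_mem _ hF)
      have hc : ConjForm (conjList (E :: Ds)) := ⟨E :: Ds, by simp, hEs, rfl⟩
      exact and _ _ hD.conjForm hc hF (base D hD) (ih (by simp) hEs hc)

theorem FOLBox.conjList_append {Ds Es : List Formula} (hD : Ds ≠ []) (hE : Es ≠ []) :
    FOLBox (((conjList Ds).and (conjList Es)).iff (conjList (Ds ++ Es))) := by
  induction Ds with
  | nil => exact absurd rfl hD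
  | cons D Ds ih =>
    cases Ds with
    | nil =>
      obtain ⟨E, Es, rfl⟩ := List.exists_cons_of_ne_nil hE
      simp only [conjList, List.cons_append, List.nil_append]
      exact of_taut
    | cons D' Ds =>
      have h := ih (by simp)
      simp only [List.cons_append, conjList] at h ⊢
      exact of_taut₁ h

/-- `A` is provably equivalent to a conjunctive form. -/
def HasConjForm (A : Formula) : Prop :=
  ∃ F : Formula, ConjForm F ∧ FOLBox (A.iff F)

/-- `A` is provably equivalent to an elementary disjunction. -/
def HasElemDisj (A : Formula) : Prop :=
  ∃ D : Formula, ElemDisj D ∧ FOLBox (A.iff D)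

namespace HasElemDisj

variable {A B C D E : Formula}

theorem of_iff (hB : HasElemDisj B) (h : FOLBox (A.iff B)) : HasElemDisj A :=
  let ⟨D, hD, hBD⟩ := hB
  ⟨D, hD, FOLBox.of_taut₂ h hBD⟩

theorem or_box (hD : HasElemDisj D) (hC : BoxFree C) : HasElemDisj (D.or C.box) :=
  let ⟨E, hE, hDE⟩ := hD
  ⟨E.or C.box, hE.or_box hC, FOLBox.of_taut₁ hDE⟩

theorem or (hD : ElemDisj D) (hE : ElemDisj E) : HasElemDisj (D.or E) := by
  induction hD using ElemDisj.induction with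
  | step D C hC _ ih => exact (ih.or_box hC).of_iff FOLBox.of_taut
  | base A B hA hB =>
    induction hE using ElemDisj.induction with
    | step E C hC _ ih => exact (ih.or_box hC).of_iff FOLBox.of_taut
    | base A' B' hA' hB' =>
      refine ⟨(A.or A').or (B.or B').dia,
        ⟨A.or A', B.or B', [], ⟨hA, hA'⟩, ⟨hB, hB'⟩, by simp, rfl⟩, ?_⟩
      have h := FOLBox.dia_or_iff B B'
      generalize (B.or B').dia = M at h ⊢
      exact FOLBox.of_taut₁ h

theorem hasConjForm (hA : HasElemDisj A) : HasConjForm A :=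
  let ⟨D, hD, h⟩ := hA
  ⟨D, hD.conjForm, h⟩

end HasElemDisj

theorem FOLBox.not_bot : FOLBox (Formula.eq 0 0).neg.neg :=
  of_taut₁ (A := Formula.eq 0 0) axId

namespace HasConjForm

variable {A B C : Formula}

theorem of_iff (hB : HasConjForm B) (h : FOLBox (A.iff B)) : HasConjForm A :=
  let ⟨D, hD, hBD⟩ := hB
  ⟨D, hD, FOLBox.of_taut₂ h hBD⟩

theorem of_boxFree (hA : BoxFree A) : HasConjForm A :=
  HasElemDisj.hasConjForm
    ⟨A.or (Formula.eq 0 0).neg.dia, ⟨A, (Formula.eq 0 0).neg, [], hA, trivial, by simp, rfl⟩,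
      FOLBox.of_taut₁ (FOLBox.nec FOLBox.not_bot)⟩

theorem dia_of_boxFree (hA : BoxFree A) : HasConjForm A.dia :=
  HasElemDisj.hasConjForm
    ⟨(Formula.eq 0 0).neg.or A.dia, ⟨(Formula.eq 0 0).neg, A, [], trivial, hA, by simp, rfl⟩,
      FOLBox.of_taut₁ FOLBox.not_bot⟩

theorem box_of_boxFree (hA : BoxFree A) : HasConjForm A.box :=
  HasElemDisj.hasConjForm
    ⟨((Formula.eq 0 0).neg.or (Formula.eq 0 0).neg.dia).or A.box,
      ⟨(Formula.eq 0 0).neg, (Formula.eq 0 0).neg, [A], trivial, trivial, by simpa using hA, rfl⟩,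
      FOLBox.of_taut₂ FOLBox.not_bot (FOLBox.nec FOLBox.not_bot)⟩

theorem and (hA : HasConjForm A) (hB : HasConjForm B) : HasConjForm (A.and B) := by
  obtain ⟨_, ⟨Ds, hne, hDs, rfl⟩, hAD⟩ := hA
  obtain ⟨_, ⟨Es, hne', hEs, rfl⟩, hBE⟩ := hB
  refine ⟨_, ⟨Ds ++ Es, by simp [hne], ?_, rfl⟩,
    FOLBox.of_taut₃ hAD hBE (FOLBox.conjList_append hne hne')⟩
  intro D hD
  exact (List.mem_append.1 hD).elim (hDs D) (hEs D)

theorem or (hA : HasConjForm A) (hB : HasConjForm B) : HasConjForm (A.or B) := by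
  obtain ⟨F, hF, hAF⟩ := hA
  obtain ⟨G, hG, hBG⟩ := hB
  suffices h : HasConjForm (F.or G) from h.of_iff (FOLBox.of_taut₂ hAF hBG)
  clear hAF hBG
  induction hF using ConjForm.induction with
  | and D E _ _ _ hD hE => exact (hD.and hE).of_iff FOLBox.of_taut
  | base D hD =>
    induction hG using ConjForm.induction with
    | and E E' _ _ _ hE hE' => exact (hE.and hE').of_iff FOLBox.of_taut
    | base E hE => exact (HasElemDisj.or hD hE).hasConjForm

theorem neg (hA : HasConjForm A) : HasConjForm A.neg := by
  obtain ⟨F, hF, hAF⟩ := hA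
  suffices h : HasConjForm F.neg from h.of_iff (FOLBox.of_taut₁ hAF)
  clear hAF
  induction hF using ConjForm.induction with
  | and D E _ _ _ hD hE => exact (hD.or hE).of_iff FOLBox.of_taut
  | base D hD =>
    induction hD using ElemDisj.induction with
    | base A B hA hB =>
      exact ((of_boxFree (A := A.neg) hA).and (box_of_boxFree (A := B.neg) hB)).of_iff
        FOLBox.of_taut
    | step D C hC _ ih =>
      have h : FOLBox (C.box.iff C.neg.neg.box) := isUniversalOp_box.congr FOLBox.of_taut
      exact (ih.and (dia_of_boxFree (A := C.neg) hC)).of_iff (FOLBox.of_taut₁ h)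

theorem imp (hA : HasConjForm A) (hB : HasConjForm B) : HasConjForm (A.imp B) :=
  (hA.neg.or hB).of_iff FOLBox.of_taut

theorem universalOp {Q : Formula → Formula} {S : Formula → Prop} (hQ : IsUniversalOp Q S)
    (hfree : ∀ A, BoxFree A → HasConjForm (Q A)) (hA : HasConjForm A) : HasConjForm (Q A) := by
  obtain ⟨F, hF, hAF⟩ := hA
  suffices h : HasConjForm (Q F) from h.of_iff (hQ.congr hAF)
  clear hAF
  induction hF using ConjForm.induction with
  | and D E _ _ _ hD hE => exact (hD.and hE).of_iff (hQ.and_iff D E)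
  | base D hD =>
    induction hD using ElemDisj.induction with
    | base A B hA hB =>
      exact ((hfree A hA).or (dia_of_boxFree hB)).of_iff (hQ.or_iff A (hQ.neg (hQ.box B.neg)))
    | step D C hC _ ih => exact (ih.or (box_of_boxFree hC)).of_iff (hQ.or_iff D (hQ.box C))

end HasConjForm

/-- Normal form lemma: every formula has an equivalent
conjunctive form, provably in FOL□. -/
theorem conjunctive_form (A : Formula) :
    ∃ F : Formula, ConjForm F ∧ FOLBox (A.iff F) := by
  change HasConjForm A
  induction A with
  | atom => exact .of_boxFree trivial
  | eq => exact .of_boxFree trivial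
  | neg A ih => exact ih.neg
  | imp A B ihA ihB => exact ihA.imp ihB
  | all x A ih =>
    exact .universalOp (isUniversalOp_all x) (fun _ hB => .of_boxFree (A := all x _) hB) ih
  | box A ih => exact .universalOp isUniversalOp_box (fun _ hB => .box_of_boxFree hB) ih

end FOLBoxPaper
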